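/- Let GF(2) be the field with two elements, let d ≥ 1 be a natural number, and let P ∈ GF(2)[x] be a nonzero polynomial having no irreducible factor of degree < d. Then every irreducible factor of gcd(x^(2^d) + x, P) has degree exactly d. -/

import Mathlib

open Polynomial

/-- **Correctness of distinct degree factorization.**
If `P ∈ GF(2)[x]` is nonzero and has no irreducible factor of degree `< d`,
then every irreducible factor of `gcd(x^(2^d) + x, P)` has degree exactly `d`. -/
theorem ddf_gcd_factors_degree (d : ℕ) (hd : 1 ≤ d)
    (P : Polynomial (ZMod 2)) (hP : P ≠ 0)
    (hmin : ∀ f : Polynomial (ZMod 2), Irreducible f → f ∣ P →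
      d ≤ f.natDegree)
    (f : Polynomial (ZMod 2)) (hf : Irreducible f)
    (hdvd : f ∣ EuclideanDomain.gcd ((X : Polynomial (ZMod 2)) ^ (2 ^ d) + X) P) :
    f.natDegree = d := by
  have hfX : f ∣ X ^ Nat.card (ZMod 2) ^ d - X := by
    rw [Nat.card_zmod, CharTwo.sub_eq_add]
    exact hdvd.trans (EuclideanDomain.gcd_dvd_left _ _)
  have hle : f.natDegree ≤ d :=
    Nat.le_of_dvd hd (hf.natDegree_dvd_of_dvd_X_pow_card_pow_sub_X hfX)
  exact hle.antisymm (hmin f hf (hdvd.trans (EuclideanDomain.gcd_dvd_right _ _)))
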